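/- Mean square error of singular-component selection filters (covering the cross-spectral Wiener filter): suppose Σ_XY·Σ_Y^{−1/2} = Σ_{i=1}^{r} σ_i·u_i·v_iᵀ where σ_i ≥ 0, (u_i)_{i=1}^{r} are orthonormal in ℝ^N and (v_i)_{i=1}^{r} are orthonormal in ℝ^M. Then for every subset 𝒥 ⊆ {1,…,r}, the filter A_𝒥 := (Σ_{i∈𝒥} σ_i·u_i·v_iᵀ)·Σ_Y^{−1/2} satisfies J(A_𝒥) = tr(Σ_X) − Σ_{i∈𝒥} σ_i². In particular, among subsets of a fixed size, J(A_𝒥) is minimized by choosing the indices with the largest σ_i. -/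

import Mathlib

open Matrix

/-- Frobenius inner product of two partial sums of a singular value decomposition. -/
theorem trace_sum_smul_vecMulVec_mul_transpose {ι m n : Type*} [DecidableEq ι]
    [Fintype m] [Fintype n] (σ : ι → ℝ) (u : ι → m → ℝ) (v : ι → n → ℝ)
    (hu : ∀ i j, u i ⬝ᵥ u j = if i = j then (1 : ℝ) else 0)
    (hv : ∀ i j, v i ⬝ᵥ v j = if i = j then (1 : ℝ) else 0)
    {s t : Finset ι} (hst : s ⊆ t) :
    ((∑ i ∈ s, σ i • vecMulVec (u i) (v i)) *
      (∑ i ∈ t, σ i • vecMulVec (u i) (v i))ᵀ).trace = ∑ i ∈ s, σ i ^ 2 := by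
  rw [Matrix.sum_mul, trace_sum]
  simp only [transpose_sum, transpose_smul, transpose_vecMulVec, Matrix.mul_sum, trace_sum,
    Matrix.smul_mul, Matrix.mul_smul, trace_smul, vecMulVec_mul_vecMulVec, trace_vecMulVec,
    dotProduct_smul, hu, hv, smul_eq_mul]
  refine Finset.sum_congr rfl fun i hi => ?_
  rw [Finset.sum_eq_single_of_mem i (hst hi) fun j _ hji => by simp [hji.symm]]
  simp [sq]

/-- Mean square error of singular-component selection filters (covering the cross-spectral
Wiener filter): if `C_XY C_Y^{−1/2} = ∑ᵢ σᵢ uᵢ vᵢᵀ` with `(uᵢ)` and `(vᵢ)` orthonormal and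
`σᵢ ≥ 0`, then for every subset `𝒥` the filter `A_𝒥 = (∑_{i∈𝒥} σᵢ uᵢ vᵢᵀ) C_Y^{−1/2}`
satisfies `J(A_𝒥) = tr(C_X) − ∑_{i∈𝒥} σᵢ²`; in particular, among subsets of a fixed size,
`J(A_𝒥)` is minimized by choosing indices with the largest `σᵢ`. -/
theorem singular_component_selection_mse
    (N M r : ℕ)
    (CX : Matrix (Fin N) (Fin N) ℝ) (CY : Matrix (Fin M) (Fin M) ℝ)
    (CXY : Matrix (Fin N) (Fin M) ℝ)
    (hX : CX.IsSymm) (hY : CY.PosDef)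
    (J : Matrix (Fin N) (Fin M) ℝ → ℝ)
    (hJ : ∀ A, J A = CX.trace - 2 * (A * CXYᵀ).trace + (A * CY * Aᵀ).trace)
    (S : Matrix (Fin M) (Fin M) ℝ) (hS : S.PosDef) (hSS : S * S = CY)
    (σ : Fin r → ℝ) (hσ : ∀ i, 0 ≤ σ i)
    (u : Fin r → Fin N → ℝ) (v : Fin r → Fin M → ℝ)
    (hu : ∀ i j, u i ⬝ᵥ u j = if i = j then (1 : ℝ) else 0)
    (hv : ∀ i j, v i ⬝ᵥ v j = if i = j then (1 : ℝ) else 0)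
    (hsvd : CXY * S⁻¹ = ∑ i : Fin r, σ i • Matrix.vecMulVec (u i) (v i)) :
    (∀ 𝒥 : Finset (Fin r),
      J ((∑ i ∈ 𝒥, σ i • Matrix.vecMulVec (u i) (v i)) * S⁻¹)
        = CX.trace - ∑ i ∈ 𝒥, σ i ^ 2) ∧
    (∀ 𝒥 𝒦 : Finset (Fin r), 𝒥.card = 𝒦.card →
      (∑ i ∈ 𝒦, σ i ^ 2) ≤ (∑ i ∈ 𝒥, σ i ^ 2) →
      J ((∑ i ∈ 𝒥, σ i • Matrix.vecMulVec (u i) (v i)) * S⁻¹)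
        ≤ J ((∑ i ∈ 𝒦, σ i • Matrix.vecMulVec (u i) (v i)) * S⁻¹)) := by
  have hSu : IsUnit S.det := (isUnit_iff_isUnit_det S).mp hS.isUnit
  have hSt : Sᵀ = S := by simpa using hS.isHermitian.eq
  have hSit : (S⁻¹)ᵀ = S⁻¹ := by rw [transpose_nonsing_inv, hSt]
  have key : ∀ 𝒥 : Finset (Fin r),
      J ((∑ i ∈ 𝒥, σ i • vecMulVec (u i) (v i)) * S⁻¹) = CX.trace - ∑ i ∈ 𝒥, σ i ^ 2 := by
    intro 𝒥
    have hcross := trace_sum_smul_vecMulVec_mul_transpose σ u v hu hv 𝒥.subset_univ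
    have hquad := trace_sum_smul_vecMulVec_mul_transpose σ u v hu hv (Finset.Subset.refl 𝒥)
    rw [← hsvd, transpose_mul, hSit, ← Matrix.mul_assoc] at hcross
    generalize ∑ i ∈ 𝒥, σ i • vecMulVec (u i) (v i) = G at hcross hquad ⊢
    have hG : G * S⁻¹ * CY * (G * S⁻¹)ᵀ = G * Gᵀ := by
      rw [transpose_mul, hSit, ← hSS, ← Matrix.mul_assoc, ← Matrix.mul_assoc,
        nonsing_inv_mul_cancel_right _ _ hSu, mul_nonsing_inv_cancel_right _ _ hSu]
    rw [hJ, hG, hcross, hquad]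
    ring
  refine ⟨key, fun 𝒥 𝒦 _ h => ?_⟩
  rw [key, key]
  exact sub_le_sub_left h _
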